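/- Let N ≥ 3 be odd and let k ≥ 1, 0 ≤ r ≤ l ≤ k be integers. Then, in the field ℚ(q,z), the lattice-point generating polynomial satisfies p_N(k,l,r;q,z) = d^e_N(k,l,r;q,z). -/

import Mathlib

/-!
STATEMENT 8: For odd N ≥ 3 and 1 ≤ k, 0 ≤ r ≤ l ≤ k,
p_N(k,l,r;q,z) = d^e_N(k,l,r;q,z) in ℚ(q,z).
-/

open MvPolynomial

noncomputable section

/-- The field `ℚ(q,z)` of rational functions in two variables. -/
abbrev K := FractionRing (MvPolynomial (Fin 2) ℚ)

/-- The variable `q` as an element of `ℚ(q,z)`. -/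
def qK : K := algebraMap (MvPolynomial (Fin 2) ℚ) K (X 0)

/-- The variable `z` as an element of `ℚ(q,z)`. -/
def zK : K := algebraMap (MvPolynomial (Fin 2) ℚ) K (X 1)

def phiQ (N : ℕ) (a : Fin N → ℤ) : ℤ := ∑ t : Fin N, (t.1 + 1 : ℤ) * a t
def phiZ (N : ℕ) (a : Fin N → ℤ) : ℤ := ∑ t : Fin N, a t

/-- The vertex `M_{m,n}` (coordinates 1-indexed in the paper; `j : Fin N`
is the coordinate `j.1 + 1`). -/
def Mvec (N : ℕ) (k l r : ℤ) (m n : ℕ) (j : Fin N) : ℤ :=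
  if j.1 + 1 ≤ m then (if (j.1 + 1) % 2 = 1 then l else k - l)
  else if N - n < j.1 + 1 then (if (N - j.1) % 2 = 1 then r else k - r)
  else 0

/-- The contribution `d^{m,n}_N(k,l,r;q,z)` of the vertex `M_{m,n}`, in `ℚ(q,z)`. -/
def dmn (N : ℕ) (k l r : ℤ) (m n : ℕ) : K :=
  qK ^ phiQ N (Mvec N k l r m n) * zK ^ phiZ N (Mvec N k l r m n) /
    ((∏ i ∈ Finset.Icc 1 (m / 2), (1 - qK ^ (i : ℤ))) *
     (∏ i ∈ Finset.Icc (m / 2 + 1) m, (1 - qK ^ (-(i : ℤ)) * zK⁻¹)) *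
     (∏ i ∈ Finset.Icc (m + 1) (N - n), (1 - qK ^ (i : ℤ) * zK)) *
     (∏ i ∈ Finset.Icc 1 (n / 2), (1 - qK ^ (-(i : ℤ)))) *
     (∏ i ∈ Finset.Icc (n / 2 + 1) n, (1 - qK ^ ((i : ℤ) - N - 1) * zK⁻¹)))

/-- `d^e_N(k,l,r;q,z)`: sum of `d^{m,n}_N` over `m, n ≥ 0` with `m+n < N`, or
`m+n = N` and `m` even. -/
def dE (N : ℕ) (k l r : ℤ) : K :=
  ∑ p ∈ (Finset.range (N + 1) ×ˢ Finset.range (N + 1)).filter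
      (fun p => p.1 + p.2 < N ∨ (p.1 + p.2 = N ∧ Even p.1)),
    dmn N k l r p.1 p.2

/-- `d^o_N(k,l,r;q,z)`: sum of `d^{m,n}_N` over `m, n ≥ 0` with `m+n < N`, or
`m+n = N` and `m` odd. -/
def dO (N : ℕ) (k l r : ℤ) : K :=
  ∑ p ∈ (Finset.range (N + 1) ×ˢ Finset.range (N + 1)).filter
      (fun p => p.1 + p.2 < N ∨ (p.1 + p.2 = N ∧ Odd p.1)),
    dmn N k l r p.1 p.2

/-- The set `A_N(k,l,r)` of lattice points of the polyhedron `P_N(k,l,r)`. -/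
def ASet (N : ℕ) (k l r : ℤ) : Set (Fin N → ℤ) :=
  {a | (∀ i, 0 ≤ a i) ∧
       (∀ h : 0 < N, a ⟨0, h⟩ ≤ l) ∧
       (∀ h : 0 < N, a ⟨N - 1, Nat.sub_lt h Nat.one_pos⟩ ≤ r) ∧
       (∀ (t : Fin N) (h : t.1 + 1 < N), a t + a ⟨t.1 + 1, h⟩ ≤ k)}

/-- The lattice-point generating polynomial `p_N(k,l,r;q,z) = ∑_{a ∈ A_N(k,l,r)}
q^{φ_q(a)} z^{φ_z(a)}`, regarded as an element of `ℚ(q,z)` (the set `A_N(k,l,r)`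
is finite, and `∑ᶠ` is the sum over it). -/
def pPoly (N : ℕ) (k l r : ℤ) : K :=
  ∑ᶠ a ∈ ASet N k l r, qK ^ phiQ N a * zK ^ phiZ N a

section GenericField

variable {F : Type*} [Field F]

/-- The bigraded weight `q^{φ_q(a)} z^{φ_z(a)}` of a lattice point. -/
def weight (q z : F) (N : ℕ) (a : Fin N → ℤ) : F := q ^ phiQ N a * z ^ phiZ N a

/-- The denominator of the contribution of the vertex `M_{m,n}`. -/
def vertexDen (q z : F) (N m n : ℕ) : F :=
  (∏ i ∈ Finset.Icc 1 (m / 2), (1 - q ^ (i : ℤ))) *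
  (∏ i ∈ Finset.Icc (m / 2 + 1) m, (1 - q ^ (-(i : ℤ)) * z⁻¹)) *
  (∏ i ∈ Finset.Icc (m + 1) (N - n), (1 - q ^ (i : ℤ) * z)) *
  (∏ i ∈ Finset.Icc 1 (n / 2), (1 - q ^ (-(i : ℤ)))) *
  (∏ i ∈ Finset.Icc (n / 2 + 1) n, (1 - q ^ ((i : ℤ) - N - 1) * z⁻¹))

/-- The contribution of the vertex `M_{m,n}` over a general field. -/
def vertexTerm (q z : F) (N : ℕ) (k l r : ℤ) (m n : ℕ) : F :=
  weight q z N (Mvec N k l r m n) / vertexDen q z N m n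

/-- The sum of the vertex contributions over `m + n < N`, together with those for `m + n = N`
where `m + e` is even. -/
def vertexSum (e : ℕ) (q z : F) (N : ℕ) (k l r : ℤ) : F :=
  ∑ p ∈ (Finset.range (N + 1) ×ˢ Finset.range (N + 1)).filter
      (fun p => p.1 + p.2 < N ∨ (p.1 + p.2 = N ∧ Even (p.1 + e))),
    vertexTerm q z N k l r p.1 p.2

/-- The lattice-point generating function over a general field, with the value at `N = 0`
normalized so that the recursion in `l` also holds for the step from `0` to `1`. -/
def latticeGen (q z : F) (N : ℕ) (k l r : ℤ) : F :=
  if N = 0 then (if k ≤ l + r then 1 else 0) else ∑ᶠ a ∈ ASet N k l r, weight q z N a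

/-- Every factor occurring in a vertex denominator is nonzero. -/
structure Generic (q z : F) : Prop where
  q_ne_zero : q ≠ 0
  z_ne_zero : z ≠ 0
  zpow_ne_one : ∀ n : ℤ, n ≠ 0 → q ^ n ≠ 1
  zpow_mul_ne_one : ∀ n : ℤ, q ^ n * z ≠ 1

namespace Generic

variable {q z : F}

lemma shift (h : Generic q z) : Generic q (q * z) where
  q_ne_zero := h.q_ne_zero
  z_ne_zero := mul_ne_zero h.q_ne_zero h.z_ne_zero
  zpow_ne_one := h.zpow_ne_one
  zpow_mul_ne_one n := by
    have := h.zpow_mul_ne_one (n + 1)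
    rwa [zpow_add_one₀ h.q_ne_zero, mul_assoc] at this

lemma one_sub_zpow_ne_zero (h : Generic q z) {n : ℤ} (hn : n ≠ 0) : 1 - q ^ n ≠ 0 :=
  sub_ne_zero.2 (h.zpow_ne_one n hn).symm

lemma one_sub_zpow_mul_ne_zero (h : Generic q z) (n : ℤ) : 1 - q ^ n * z ≠ 0 :=
  sub_ne_zero.2 (h.zpow_mul_ne_one n).symm

lemma one_sub_zpow_mul_inv_ne_zero (h : Generic q z) (n : ℤ) : 1 - q ^ n * z⁻¹ ≠ 0 := by
  intro h0
  apply h.zpow_mul_ne_one (-n)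
  have h1 : q ^ n * z⁻¹ = 1 := (sub_eq_zero.1 h0).symm
  rw [zpow_neg, ← inv_inj, mul_inv, inv_inv, h1, inv_one]

end Generic

/-! ### Lattice points -/

lemma phiZ_cons (N : ℕ) (x : ℤ) (b : Fin N → ℤ) :
    phiZ (N + 1) (Fin.cons x b) = x + phiZ N b := by
  simp [phiZ, Fin.sum_univ_succ]

lemma phiQ_cons (N : ℕ) (x : ℤ) (b : Fin N → ℤ) :
    phiQ (N + 1) (Fin.cons x b) = x + (phiQ N b + phiZ N b) := by
  simp only [phiQ, phiZ, Fin.sum_univ_succ, Fin.cons_zero, Fin.cons_succ, ← Finset.sum_add_distrib]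
  congr 1
  · simp
  · refine Finset.sum_congr rfl fun i _ => ?_
    simp
    ring

lemma weight_cons {q z : F} (hq : q ≠ 0) (hz : z ≠ 0) (N : ℕ) (x : ℤ) (b : Fin N → ℤ) :
    weight q z (N + 1) (Fin.cons x b) = (q * z) ^ x * weight q (q * z) N b := by
  simp only [weight, phiZ_cons, phiQ_cons, mul_zpow, zpow_add₀ hq, zpow_add₀ hz]
  ring

lemma ASet_finite (N : ℕ) (k l r : ℤ) : (ASet N k l r).Finite := by
  refine (Set.finite_Icc (0 : Fin N → ℤ) (fun _ => max k l)).subset ?_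
  rintro a ⟨h0, h1, -, h3⟩
  refine ⟨h0, fun ⟨i, hi⟩ => ?_⟩
  cases i with
  | zero => exact (h1 hi).trans (le_max_right _ _)
  | succ i =>
    have h4 := h3 ⟨i, by omega⟩ hi
    have h5 := h0 ⟨i, by omega⟩
    have := le_max_left k l
    simp only at h4 ⊢
    linarith

lemma ASet_eq_empty {N : ℕ} (hN : 0 < N) {k l r : ℤ} (hl : l < 0) : ASet N k l r = ∅ := by
  ext a
  simp only [Set.mem_empty_iff_false, iff_false]
  rintro ⟨h0, h1, -, -⟩
  have := h0 ⟨0, hN⟩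
  have := h1 hN
  omega

lemma cons_mem_ASet {N : ℕ} (hN : 0 < N) {k l r x : ℤ} {b : Fin N → ℤ} :
    (Fin.cons x b : Fin (N + 1) → ℤ) ∈ ASet (N + 1) k l r ↔
      0 ≤ x ∧ x ≤ l ∧ b ∈ ASet N k (k - x) r := by
  have e : ∀ (i : ℕ) (h : i + 1 < N + 1), (⟨i + 1, h⟩ : Fin (N + 1)) =
      Fin.succ ⟨i, by omega⟩ := fun i h => rfl
  have elast : (⟨N + 1 - 1, by omega⟩ : Fin (N + 1)) = Fin.succ ⟨N - 1, by omega⟩ := by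
    ext; simp; omega
  have ezero : ∀ h : 0 < N + 1, (⟨0, h⟩ : Fin (N + 1)) = 0 := fun h => rfl
  constructor
  · rintro ⟨h0, h1, h2, h3⟩
    refine ⟨by simpa using h0 0, by simpa [ezero] using h1 (by omega), ?_, ?_, ?_, ?_⟩
    · exact fun i => by simpa using h0 i.succ
    · intro h
      have := h3 0 (by simpa using h)
      simp only [Fin.val_zero, e, Fin.cons_zero, Fin.cons_succ] at this
      linarith
    · intro h
      have := h2 (by omega)
      rw [elast, Fin.cons_succ] at this
      exact this
    · intro t h
      have := h3 t.succ (by simpa using h)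
      simp only [Fin.val_succ, e, Fin.cons_succ] at this
      exact this
  · rintro ⟨hx, hxl, h0, h1, h2, h3⟩
    refine ⟨?_, ?_, ?_, ?_⟩
    · intro i
      refine Fin.cases ?_ (fun i => ?_) i
      · simpa using hx
      · simpa using h0 i
    · intro h
      rw [ezero, Fin.cons_zero]
      exact hxl
    · intro h
      rw [elast, Fin.cons_succ]
      exact h2 hN
    · intro t
      refine Fin.cases ?_ (fun t => ?_) t
      · intro h
        have := h1 hN
        simp only [Fin.val_zero, e, Fin.cons_zero, Fin.cons_succ]
        linarith
      · intro h
        simp only [Fin.val_succ, e, Fin.cons_succ]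
        exact h3 t (by simpa using h)

lemma ASet_succ {N : ℕ} (hN : 0 < N) {k l r : ℤ} (hl : 0 ≤ l) :
    ASet (N + 1) k l r = ASet (N + 1) k (l - 1) r ∪ Fin.cons l '' ASet N k (k - l) r := by
  ext a
  refine Fin.consCases (fun x b => ?_) a
  simp only [Set.mem_union, Set.mem_image, cons_mem_ASet hN, Fin.cons_inj]
  constructor
  · rintro ⟨h1, h2, h3⟩
    rcases h2.lt_or_eq with h | rfl
    · exact Or.inl ⟨h1, by omega, h3⟩
    · exact Or.inr ⟨b, h3, rfl, rfl⟩
  · rintro (⟨h1, h2, h3⟩ | ⟨b, h3, rfl, rfl⟩)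
    · exact ⟨h1, by omega, h3⟩
    · exact ⟨hl, le_rfl, h3⟩

lemma ASet_one (k l r : ℤ) :
    ASet 1 k l r = (fun x _ => x) '' Set.Icc 0 (min l r) := by
  ext a
  constructor
  · rintro ⟨h0, h1, h2, -⟩
    refine ⟨a 0, ⟨h0 0, le_min (h1 one_pos) (h2 one_pos)⟩, ?_⟩
    ext i
    rw [Subsingleton.elim i 0]
  · rintro ⟨x, ⟨h0, h1⟩, rfl⟩
    refine ⟨fun _ => h0, fun _ => h1.trans (min_le_left _ _), fun _ => h1.trans (min_le_right _ _),
      fun t h => ?_⟩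
    omega

lemma latticeGen_neg_one (q z : F) (N : ℕ) (k r : ℤ) :
    latticeGen q z (N + 1) k (-1) r = 0 := by
  simp [latticeGen, ASet_eq_empty (Nat.succ_pos N) (show (-1 : ℤ) < 0 by norm_num)]

lemma latticeGen_one_step (q z : F) (k l r : ℤ) (hl : 0 ≤ l) :
    latticeGen q z 1 k l r =
      latticeGen q z 1 k (l - 1) r + (q * z) ^ l * latticeGen q (q * z) 0 k (k - l) r := by
  have hinj : Function.Injective (fun (x : ℤ) (_ : Fin 1) => x) := fun x y h => congrFun h 0
  have hw : ∀ x : ℤ, weight q z 1 (fun _ => x) = (q * z) ^ x := fun x => by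
    simp [weight, phiQ, phiZ, mul_zpow]
  simp only [latticeGen, one_ne_zero, if_false, if_true, ASet_one,
    finsum_mem_image hinj.injOn, hw]
  by_cases h : l ≤ r
  · have e : Set.Icc 0 (min l r) = insert l (Set.Icc 0 (min (l - 1) r)) := by
      ext x
      simp only [Set.mem_Icc, Set.mem_insert_iff]
      omega
    rw [e, finsum_mem_insert _ (by simp) (Set.finite_Icc _ _), if_pos (by omega), mul_one, add_comm]
  · rw [if_neg (by omega), min_eq_right (by omega), min_eq_right (by omega), mul_zero, add_zero]

lemma latticeGen_step {q z : F} (hq : q ≠ 0) (hz : z ≠ 0) (N : ℕ) (k l r : ℤ) (hl : 0 ≤ l) :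
    latticeGen q z (N + 1) k l r =
      latticeGen q z (N + 1) k (l - 1) r + (q * z) ^ l * latticeGen q (q * z) N k (k - l) r := by
  rcases Nat.eq_zero_or_pos N with rfl | hN
  · exact latticeGen_one_step q z k l r hl
  have hdisj : Disjoint (ASet (N + 1) k (l - 1) r) (Fin.cons l '' ASet N k (k - l) r) := by
    rw [Set.disjoint_left]
    rintro _ ha ⟨b, hb, rfl⟩
    have := ((cons_mem_ASet hN).1 ha).2.1
    omega
  simp only [latticeGen, hN.ne', Nat.succ_ne_zero, if_false]
  rw [ASet_succ hN hl, finsum_mem_union hdisj (ASet_finite _ _ _ _)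
    ((ASet_finite _ _ _ _).image _),
    finsum_mem_image (Fin.cons_right_injective (α := fun _ => ℤ) l).injOn]
  simp only [weight_cons hq hz]
  rw [mul_finsum_mem]

/-! ### The vertices `M_{m,n}` -/

lemma Mvec_succ_succ (N : ℕ) (k l r : ℤ) (m n : ℕ) :
    Mvec (N + 1) k l r (m + 1) n = Fin.cons l (Mvec N k (k - l) r m n) := by
  ext j
  refine Fin.cases ?_ (fun j => ?_) j
  · simp [Mvec]
  · have := j.2
    simp only [Mvec, Fin.cons_succ, Fin.val_succ]
    split_ifs <;> omega

lemma Mvec_zero (N : ℕ) (k l l' r : ℤ) (n : ℕ) : Mvec N k l r 0 n = Mvec N k l' r 0 n := by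
  ext j
  simp [Mvec]

lemma phi_Mvec_sub (N : ℕ) (k r : ℤ) (n : ℕ) : ∀ (m : ℕ) (l l' : ℤ), m ≤ N →
    phiZ N (Mvec N k l r m n) - phiZ N (Mvec N k l' r m n) = (if Even m then 0 else (l - l')) ∧
    phiQ N (Mvec N k l r m n) - phiQ N (Mvec N k l' r m n) =
      (l - l') * (if Even m then -((m / 2 : ℕ) : ℤ) else ((m / 2 : ℕ) : ℤ) + 1) := by
  induction N with
  | zero =>
    intro m l l' h
    obtain rfl : m = 0 := by omega
    simp [Mvec_zero 0 k l l']
  | succ N ih =>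
    intro m l l' h
    cases m with
    | zero => simp [Mvec_zero (N + 1) k l l']
    | succ m =>
      obtain ⟨h1, h2⟩ := ih m (k - l) (k - l') (by omega)
      simp only [Mvec_succ_succ, phiZ_cons, phiQ_cons, Nat.even_add_one]
      rcases Nat.even_or_odd' m with ⟨t, rfl | rfl⟩
      · have e : (2 * t + 1) / 2 = t := by omega
        have e' : (2 * t) / 2 = t := by omega
        have he : Even (2 * t) := even_two_mul t
        simp only [he, not_true, if_true, if_false, e, e'] at h1 h2 ⊢
        constructor
        · linear_combination h1
        · linear_combination h1 + h2
      · have e : (2 * t + 1 + 1) / 2 = t + 1 := by omega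
        have e' : (2 * t + 1) / 2 = t := by omega
        have he : ¬ Even (2 * t + 1) := by simp
        simp only [he, not_false_iff, if_true, if_false, e, e'] at h1 h2 ⊢
        push_cast
        constructor
        · linear_combination h1
        · linear_combination h1 + h2

lemma Mvec_succ_left {N m n : ℕ} (h : m + n < N) (hm : Even m) (k l r : ℤ) :
    Mvec N k l r (m + 1) n = Mvec N k l r m n + Pi.single ⟨m, by omega⟩ l := by
  have hm' : m % 2 = 0 := Nat.even_iff.1 hm
  ext ⟨j, hj⟩
  simp only [Mvec, Pi.add_apply, Pi.single_apply, Fin.mk.injEq]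
  split_ifs <;> omega

lemma weight_Mvec_succ_left {q z : F} (hq : q ≠ 0) (hz : z ≠ 0) {N m n : ℕ} (h : m + n < N)
    (hm : Even m) (k l r : ℤ) :
    weight q z N (Mvec N k l r (m + 1) n) =
      weight q z N (Mvec N k l r m n) * (q ^ ((m : ℤ) + 1) * z) ^ l := by
  have h1 : phiZ N (Mvec N k l r (m + 1) n) = phiZ N (Mvec N k l r m n) + l := by
    simp [phiZ, Mvec_succ_left h hm, Finset.sum_add_distrib]
  have h2 : phiQ N (Mvec N k l r (m + 1) n) = phiQ N (Mvec N k l r m n) + (m + 1) * l := by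
    simp [phiQ, Mvec_succ_left h hm, Finset.sum_add_distrib, mul_add, Pi.single_apply]
  simp only [weight, h1, h2, zpow_add₀ hq, zpow_add₀ hz, mul_zpow, zpow_mul]
  ring

lemma Mvec_of_add_eq {N m n : ℕ} (h : m + n = N) {k l r : ℤ}
    (hr : (if Odd N then r else k - r) = l) : Mvec N k l r m n = Mvec N k l r N 0 := by
  ext ⟨j, hj⟩
  simp only [Mvec, Nat.odd_iff] at *
  split_ifs at * <;> omega

/-! ### Denominators -/

/-- The ratio of `vertexDen` at `m + 1` to its shift at `m`. -/
def stepFactor (q z : F) (m : ℕ) : F :=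
  if Even m then 1 - q ^ (-((m / 2 : ℕ) : ℤ) - 1) * z⁻¹ else 1 - q ^ (((m / 2 : ℕ) : ℤ) + 1)

lemma Generic.stepFactor_ne_zero {q z : F} (h : Generic q z) (m : ℕ) : stepFactor q z m ≠ 0 := by
  unfold stepFactor
  split_ifs
  · exact h.one_sub_zpow_mul_inv_ne_zero _
  · exact h.one_sub_zpow_ne_zero (by omega)

lemma prod_Icc_add_one (f : ℕ → F) (a b : ℕ) :
    ∏ i ∈ Finset.Icc (a + 1) (b + 1), f i = ∏ i ∈ Finset.Icc a b, f (i + 1) := by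
  refine Finset.prod_nbij' (fun i => i - 1) (fun i => i + 1) ?_ ?_ ?_ ?_ ?_ <;>
    simp only [Finset.mem_Icc] <;> intro i hi
  · omega
  · omega
  · omega
  · omega
  · congr 1; omega

lemma vertexDen_succ {q z : F} (hq : q ≠ 0) {N m n : ℕ} (h : m + n ≤ N) :
    vertexDen q z (N + 1) (m + 1) n = stepFactor q z m * vertexDen q (q * z) N m n := by
  have h2 : ∏ i ∈ Finset.Icc (m / 2 + 1) m, (1 - q ^ (-(i : ℤ)) * (q * z)⁻¹) =
      ∏ i ∈ Finset.Icc (m / 2 + 2) (m + 1), (1 - q ^ (-(i : ℤ)) * z⁻¹) := by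
    rw [prod_Icc_add_one]
    refine Finset.prod_congr rfl fun i _ => ?_
    rw [mul_inv, ← mul_assoc, ← zpow_sub_one₀ hq]
    push_cast
    ring_nf
  have h3 : ∏ i ∈ Finset.Icc (m + 1) (N - n), (1 - q ^ (i : ℤ) * (q * z)) =
      ∏ i ∈ Finset.Icc (m + 1 + 1) (N + 1 - n), (1 - q ^ (i : ℤ) * z) := by
    rw [show N + 1 - n = N - n + 1 by omega, prod_Icc_add_one]
    refine Finset.prod_congr rfl fun i _ => ?_
    rw [← mul_assoc, ← zpow_add_one₀ hq]
    push_cast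
    rfl
  have h5 : ∏ i ∈ Finset.Icc (n / 2 + 1) n, (1 - q ^ ((i : ℤ) - N - 1) * (q * z)⁻¹) =
      ∏ i ∈ Finset.Icc (n / 2 + 1) n, (1 - q ^ ((i : ℤ) - (N + 1 : ℕ) - 1) * z⁻¹) := by
    refine Finset.prod_congr rfl fun i _ => ?_
    rw [mul_inv, ← mul_assoc, ← zpow_sub_one₀ hq]
    push_cast
    ring_nf
  simp only [vertexDen, h2, h3, h5]
  unfold stepFactor
  rcases Nat.even_or_odd' m with ⟨t, rfl | rfl⟩
  · have e : (2 * t + 1) / 2 = t := by omega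
    have e' : (2 * t) / 2 = t := by omega
    rw [if_pos (even_two_mul t), e, e',
      ← Finset.mul_prod_Ioc_eq_prod_Icc (show t + 1 ≤ 2 * t + 1 by omega)]
    rw [show Finset.Ioc (t + 1) (2 * t + 1) = Finset.Icc (t + 2) (2 * t + 1) by ext; simp; omega]
    push_cast
    rw [neg_add']
    ring
  · have e : (2 * t + 1 + 1) / 2 = t + 1 := by omega
    have e' : (2 * t + 1) / 2 = t := by omega
    rw [if_neg (by simp), e, e', Finset.prod_Icc_succ_top (show 1 ≤ t + 1 by omega)]
    push_cast
    ring

lemma vertexDen_two_mul_add_one {q z : F} {N t n : ℕ} (h : 2 * t + n < N) :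
    vertexDen q z N (2 * t + 1) n * (1 - q ^ ((2 * t : ℤ) + 1) * z) =
      vertexDen q z N (2 * t) n * (1 - q ^ (-((2 * t : ℤ) + 1)) * z⁻¹) := by
  have e : (2 * t + 1) / 2 = t := by omega
  have e' : (2 * t) / 2 = t := by omega
  simp only [vertexDen, e, e']
  rw [Finset.prod_Icc_succ_top (show t + 1 ≤ 2 * t + 1 by omega),
    ← Finset.mul_prod_Ioc_eq_prod_Icc (show 2 * t + 1 ≤ N - n by omega),
    show Finset.Ioc (2 * t + 1) (N - n) = Finset.Icc (2 * t + 1 + 1) (N - n) by ext; simp]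
  push_cast
  ring

lemma Generic.vertexDen_ne_zero {q z : F} (h : Generic q z) (N m n : ℕ) :
    vertexDen q z N m n ≠ 0 := by
  unfold vertexDen
  refine mul_ne_zero (mul_ne_zero (mul_ne_zero (mul_ne_zero ?_ ?_) ?_) ?_) ?_ <;>
    refine Finset.prod_ne_zero_iff.2 fun i hi => ?_ <;> rw [Finset.mem_Icc] at hi
  · exact h.one_sub_zpow_ne_zero (by omega)
  · exact h.one_sub_zpow_mul_inv_ne_zero _
  · exact h.one_sub_zpow_mul_ne_zero _
  · exact h.one_sub_zpow_ne_zero (by omega)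
  · exact h.one_sub_zpow_mul_inv_ne_zero _

/-! ### The recursion for the vertex sums -/

lemma Generic.vertexTerm_step {q z : F} (h : Generic q z) {N m n : ℕ} (hmn : m + n ≤ N)
    (k l r : ℤ) :
    vertexTerm q z (N + 1) k l r (m + 1) n =
      vertexTerm q z (N + 1) k (l - 1) r (m + 1) n +
        (q * z) ^ l * vertexTerm q (q * z) N k (k - l) r m n := by
  have hq := h.q_ne_zero
  have hz := h.z_ne_zero
  have hs := h.stepFactor_ne_zero m
  have hd := h.shift.vertexDen_ne_zero N m n
  obtain ⟨h1, h2⟩ := phi_Mvec_sub (N + 1) k r n (m + 1) (l - 1) l (by omega)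
  have key : weight q z (N + 1) (Mvec (N + 1) k (l - 1) r (m + 1) n) =
      weight q z (N + 1) (Mvec (N + 1) k l r (m + 1) n) * (1 - stepFactor q z m) := by
    rw [sub_eq_iff_eq_add] at h1 h2
    simp only [weight, h1, h2, zpow_add₀ hq, zpow_add₀ hz, stepFactor, Nat.even_add_one]
    rcases Nat.even_or_odd' m with ⟨t, rfl | rfl⟩
    · have e : (2 * t + 1) / 2 = t := by omega
      have e' : (2 * t) / 2 = t := by omega
      rw [if_neg (by simp), if_neg (by simp), if_pos (by simp), e, e',
        show l - 1 - l = (-1 : ℤ) by ring, zpow_neg_one,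
        show (-1 : ℤ) * ((t : ℤ) + 1) = -t - 1 by ring]
      ring
    · have e : (2 * t + 1 + 1) / 2 = t + 1 := by omega
      have e' : (2 * t + 1) / 2 = t := by omega
      rw [if_pos (by simp), if_pos (by simp), if_neg (by simp), e, e',
        show (l - 1 - l) * (-((t + 1 : ℕ) : ℤ)) = t + 1 by push_cast; ring, zpow_zero, zpow_add₀ hq]
      ring
  simp only [vertexTerm, key]
  rw [vertexDen_succ hq hmn, Mvec_succ_succ, weight_cons hq hz]
  field_simp
  ring

lemma Generic.vertexSum_step {q z : F} (h : Generic q z) (e N : ℕ) (k l r : ℤ) :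
    vertexSum e q z (N + 1) k l r =
      vertexSum e q z (N + 1) k (l - 1) r +
        (q * z) ^ l * vertexSum (e + 1) q (q * z) N k (k - l) r := by
  have hpeel : ∀ l', vertexSum e q z (N + 1) k l' r =
      ∑ m ∈ Finset.range (N + 1), ∑ n ∈ Finset.range (N + 2),
        (if m + 1 + n < N + 1 ∨ m + 1 + n = N + 1 ∧ Even (m + 1 + e) then
          vertexTerm q z (N + 1) k l' r (m + 1) n else 0) +
      ∑ n ∈ Finset.range (N + 2), (if 0 + n < N + 1 ∨ 0 + n = N + 1 ∧ Even (0 + e) then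
          vertexTerm q z (N + 1) k l' r 0 n else 0) := fun l' => by
    simp only [vertexSum, Finset.sum_filter, Finset.sum_product]
    exact Finset.sum_range_succ' _ _
  rw [hpeel, hpeel]
  have h0 : ∀ n, vertexTerm q z (N + 1) k l r 0 n = vertexTerm q z (N + 1) k (l - 1) r 0 n :=
    fun n => by simp only [vertexTerm, Mvec_zero (N + 1) k l (l - 1)]
  simp only [h0]
  rw [add_right_comm]
  congr 1
  simp only [vertexSum, Finset.sum_filter, Finset.sum_product]
  rw [Finset.mul_sum, ← Finset.sum_add_distrib]
  refine Finset.sum_congr rfl fun m hm => ?_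
  rw [Finset.sum_range_succ, Finset.sum_range_succ _ (N + 1)]
  rw [if_neg (by omega), if_neg (by omega), add_zero, add_zero, Finset.mul_sum,
    ← Finset.sum_add_distrib]
  refine Finset.sum_congr rfl fun n hn => ?_
  have hiff : (m + 1 + n < N + 1 ∨ m + 1 + n = N + 1 ∧ Even (m + 1 + e)) ↔
      (m + n < N ∨ m + n = N ∧ Even (m + (e + 1))) := by
    rw [show m + 1 + e = m + (e + 1) by ring]
    refine or_congr (by omega) (and_congr_left' (by omega))
  by_cases hc : m + n < N ∨ m + n = N ∧ Even (m + (e + 1))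
  · rw [if_pos (hiff.2 hc), if_pos (hiff.2 hc), if_pos hc]
    exact h.vertexTerm_step (by omega) k l r
  · rw [if_neg (fun h => hc (hiff.1 h)), if_neg (fun h => hc (hiff.1 h)), if_neg hc]
    simp

lemma vertexSum_add_two (e : ℕ) (q z : F) (N : ℕ) (k l r : ℤ) :
    vertexSum (e + 2) q z N k l r = vertexSum e q z N k l r := by
  simp [vertexSum, ← add_assoc, Nat.even_add]

lemma Generic.vertexTerm_add_neg_one {q z : F} (h : Generic q z) {N t n : ℕ} (hn : 2 * t + n < N)
    (k r : ℤ) :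
    vertexTerm q z N k (-1) r (2 * t) n + vertexTerm q z N k (-1) r (2 * t + 1) n = 0 := by
  have hd := vertexDen_two_mul_add_one (q := q) (z := z) hn
  have h0 := h.vertexDen_ne_zero N (2 * t) n
  have h1 := h.vertexDen_ne_zero N (2 * t + 1) n
  have hw : q ^ ((2 * t : ℤ) + 1) * z ≠ 0 :=
    mul_ne_zero (zpow_ne_zero _ h.q_ne_zero) h.z_ne_zero
  have hw1 := h.one_sub_zpow_mul_ne_zero ((2 * t : ℤ) + 1)
  rw [zpow_neg, ← mul_inv] at hd
  simp only [vertexTerm, weight_Mvec_succ_left h.q_ne_zero h.z_ne_zero hn (even_two_mul t),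
    zpow_neg_one]
  push_cast
  generalize q ^ ((2 * t : ℤ) + 1) * z = x at *
  generalize vertexDen q z N (2 * t) n = A at *
  generalize vertexDen q z N (2 * t + 1) n = B at *
  have hB : B = -(A * x⁻¹) := by
    apply mul_right_cancel₀ hw1
    rw [hd]
    field_simp
    ring
  subst hB
  field_simp
  ring

lemma Generic.vertexSum_one_neg_one {q z : F} (h : Generic q z) (N : ℕ) (k r : ℤ) :
    vertexSum 1 q z N k (-1) r = 0 := by
  unfold vertexSum
  refine Finset.sum_involution (fun p _ => (if Even p.1 then p.1 + 1 else p.1 - 1, p.2)) ?_ ?_ ?_ ?_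
  · rintro ⟨m, n⟩ hm
    simp only [Finset.mem_filter, Nat.even_add_one] at hm
    rcases Nat.even_or_odd' m with ⟨t, rfl | rfl⟩
    · simp only [even_two_mul, if_true, not_true, and_false, or_false] at hm ⊢
      exact h.vertexTerm_add_neg_one hm.2 k r
    · rw [if_neg (by simp), add_comm]
      exact h.vertexTerm_add_neg_one (by omega) k r
  · rintro ⟨m, n⟩ - - heq
    simp only [Prod.mk.injEq, and_true] at heq
    split_ifs at heq with he
    · omega
    · rw [Nat.not_even_iff] at he
      omega
  · rintro ⟨m, n⟩ hm
    simp only [Finset.mem_filter, Finset.mem_product, Finset.mem_range, Nat.even_iff] at hm ⊢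
    split_ifs <;> omega
  · rintro ⟨m, n⟩ hm
    simp only [Prod.mk.injEq, and_true, Nat.even_iff]
    split_ifs <;> omega

/-! ### Comparing the two vertex sums -/

lemma sum_range_two_mul (f : ℕ → F) (n : ℕ) :
    ∑ i ∈ Finset.range (2 * n), f i = ∑ t ∈ Finset.range n, (f (2 * t) + f (2 * t + 1)) := by
  induction n with
  | zero => simp
  | succ n ih =>
    rw [show 2 * (n + 1) = 2 * n + 1 + 1 by ring, Finset.sum_range_succ, Finset.sum_range_succ,
      Finset.sum_range_succ, ih]
    ring

lemma vertexDen_of_add_eq (q z : F) {N m n : ℕ} (h : m + n = N) :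
    vertexDen q z N m n =
      (∏ i ∈ Finset.Icc 1 (m / 2), (1 - q ^ (i : ℤ))) *
      (∏ i ∈ Finset.Icc 1 (n / 2), (1 - q ^ (-(i : ℤ)))) *
      ∏ i ∈ Finset.Ioc (m / 2) (N - n / 2), (1 - q ^ (-(i : ℤ)) * z⁻¹) := by
  have h5 : ∏ i ∈ Finset.Icc (n / 2 + 1) n, (1 - q ^ ((i : ℤ) - N - 1) * z⁻¹) =
      ∏ i ∈ Finset.Ioc m (N - n / 2), (1 - q ^ (-(i : ℤ)) * z⁻¹) := by
    refine Finset.prod_nbij' (fun i => N + 1 - i) (fun i => N + 1 - i) ?_ ?_ ?_ ?_ ?_ <;>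
      simp only [Finset.mem_Icc, Finset.mem_Ioc] <;> intro i hi
    · omega
    · omega
    · omega
    · omega
    · rw [show (i : ℤ) - N - 1 = -((N + 1 - i : ℕ) : ℤ) by omega]
  have h2 : Finset.Icc (m / 2 + 1) m = Finset.Ioc (m / 2) m := by ext; simp
  have h3 : Finset.Icc (m + 1) (N - n) = ∅ := Finset.Icc_eq_empty (by omega)
  rw [vertexDen, h5, h2, h3, ← Finset.prod_Ioc_consecutive _ (show m / 2 ≤ m by omega)
    (show m ≤ N - n / 2 by omega)]
  simp
  ring

/-- The alternating sum of the inverse denominators on the line `m + n = 2M` vanishes. -/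
lemma Generic.sum_inv_vertexDen_even {q z : F} (h : Generic q z) {M : ℕ} (hM : 0 < M) :
    ∑ t ∈ Finset.range (M + 1), (vertexDen q z (2 * M) (2 * t) (2 * M - 2 * t))⁻¹ =
      ∑ t ∈ Finset.range M, (vertexDen q z (2 * M) (2 * t + 1) (2 * M - (2 * t + 1)))⁻¹ := by
  set a : ℕ → F := fun t => ∏ i ∈ Finset.Icc 1 t, (1 - q ^ (i : ℤ)) with ha
  set b : ℕ → F := fun t => ∏ i ∈ Finset.Icc 1 t, (1 - q ^ (-(i : ℤ))) with hb
  set x : ℕ → F := fun i => 1 - q ^ (-(i : ℤ)) * z⁻¹ with hx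
  set A : ℕ → F := fun t => (∏ i ∈ Finset.Ioc t (t + M), x i)⁻¹ with hA
  have hq := h.q_ne_zero
  have ha0 : ∀ t, a t ≠ 0 := fun t => Finset.prod_ne_zero_iff.2 fun i hi =>
    h.one_sub_zpow_ne_zero (by rw [Finset.mem_Icc] at hi; omega)
  have hb0 : ∀ t, b t ≠ 0 := fun t => Finset.prod_ne_zero_iff.2 fun i hi =>
    h.one_sub_zpow_ne_zero (by rw [Finset.mem_Icc] at hi; omega)
  have hx0 : ∀ i, x i ≠ 0 := fun i => h.one_sub_zpow_mul_inv_ne_zero _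
  have ha1 : ∀ t, a (t + 1) = a t * (1 - q ^ ((t : ℤ) + 1)) := fun t => by
    simp only [ha]; rw [Finset.prod_Icc_succ_top (by omega)]; push_cast; rfl
  have hb1 : ∀ t, b (t + 1) = b t * (1 - q ^ (-((t : ℤ) + 1))) := fun t => by
    simp only [hb]; rw [Finset.prod_Icc_succ_top (by omega)]; push_cast; rfl
  have hM1 : 1 - q ^ (M : ℤ) ≠ 0 := h.one_sub_zpow_ne_zero (by omega)
  have hM2 : 1 - q ^ (-(M : ℤ)) ≠ 0 := h.one_sub_zpow_ne_zero (by omega)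
  have hL : ∀ t ∈ Finset.range (M + 1), (vertexDen q z (2 * M) (2 * t) (2 * M - 2 * t))⁻¹ =
      (a t)⁻¹ * (b (M - t))⁻¹ * A t := by
    intro t ht
    rw [Finset.mem_range] at ht
    rw [vertexDen_of_add_eq q z (by omega), mul_inv, mul_inv, show 2 * t / 2 = t by omega,
      show (2 * M - 2 * t) / 2 = M - t by omega, show 2 * M - (M - t) = t + M by omega]
  have hR : ∀ t ∈ Finset.range M,
      (vertexDen q z (2 * M) (2 * t + 1) (2 * M - (2 * t + 1)))⁻¹ =
      (a t)⁻¹ * (b (M - 1 - t))⁻¹ * (1 - q ^ (-(M : ℤ)))⁻¹ * A t +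
        (a t)⁻¹ * (b (M - 1 - t))⁻¹ * (1 - q ^ (M : ℤ))⁻¹ * A (t + 1) := by
    intro t ht
    rw [Finset.mem_range] at ht
    rw [vertexDen_of_add_eq q z (by omega), mul_inv, mul_inv, show (2 * t + 1) / 2 = t by omega,
      show (2 * M - (2 * t + 1)) / 2 = M - 1 - t by omega,
      show 2 * M - (M - 1 - t) = t + M + 1 by omega]
    have e1 : A t = x (t + M + 1) * (∏ i ∈ Finset.Ioc t (t + M + 1), x i)⁻¹ := by
      simp only [hA]
      rw [Finset.prod_Ioc_succ_top (by omega), mul_inv]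
      field_simp [hx0]
    have e2 : A (t + 1) = x (t + 1) * (∏ i ∈ Finset.Ioc t (t + M + 1), x i)⁻¹ := by
      simp only [hA]
      rw [show t + 1 + M = t + M + 1 by ring,
        ← Finset.prod_Ioc_consecutive _ (show t ≤ t + 1 by omega) (show t + 1 ≤ t + M + 1 by omega),
        mul_inv]
      simp only [Nat.Ioc_succ_singleton, Finset.prod_singleton]
      field_simp [hx0]
    have e3 : (1 - q ^ (-(M : ℤ)))⁻¹ * x (t + M + 1) + (1 - q ^ (M : ℤ))⁻¹ * x (t + 1) = 1 := by
      have e4 : q ^ (-((t + M + 1 : ℕ) : ℤ)) = q ^ (-((t + 1 : ℕ) : ℤ)) * (q ^ (M : ℤ))⁻¹ := by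
        rw [← zpow_neg, ← zpow_add₀ hq]
        push_cast
        ring_nf
      simp only [hx, e4]
      have hqM : q ^ (M : ℤ) ≠ 0 := zpow_ne_zero _ hq
      rw [zpow_neg] at hM2 ⊢
      generalize q ^ (M : ℤ) = y at *
      generalize q ^ (-((t + 1 : ℕ) : ℤ)) = w at *
      have : y - 1 ≠ 0 := fun h0 => hM1 (by linear_combination -h0)
      rw [show (1 - y⁻¹)⁻¹ = y * (y - 1)⁻¹ by field_simp,
        show (1 - y)⁻¹ = - (y - 1)⁻¹ by rw [← inv_neg]; congr 1; ring]
      field_simp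
      ring
    rw [e1, e2]
    linear_combination -((a t)⁻¹ * (b (M - 1 - t))⁻¹ * (∏ i ∈ Finset.Ioc t (t + M + 1), x i)⁻¹) * e3
  rw [Finset.sum_congr rfl hL, Finset.sum_congr rfl hR, Finset.sum_add_distrib]
  set u : ℕ → F := fun t => (a t)⁻¹ * (b (M - t))⁻¹ * A t with hu
  have c1 : ∑ t ∈ Finset.range M, (a t)⁻¹ * (b (M - 1 - t))⁻¹ * (1 - q ^ (-(M : ℤ)))⁻¹ * A t =
      ∑ t ∈ Finset.range (M + 1), u t * ((1 - q ^ ((t : ℤ) - M)) * (1 - q ^ (-(M : ℤ)))⁻¹) := by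
    rw [Finset.sum_range_succ]
    simp only [sub_self, zpow_zero, zero_mul, mul_zero, add_zero]
    refine Finset.sum_congr rfl fun t ht => ?_
    rw [Finset.mem_range] at ht
    simp only [hu]
    have hne : 1 - q ^ ((t : ℤ) - M) ≠ 0 := h.one_sub_zpow_ne_zero (by omega)
    rw [show M - t = M - 1 - t + 1 by omega, hb1,
      show -(((M - 1 - t : ℕ) : ℤ) + 1) = t - M by omega, mul_inv]
    have := hb0 (M - 1 - t)
    field_simp
  have c2 : ∑ t ∈ Finset.range M, (a t)⁻¹ * (b (M - 1 - t))⁻¹ * (1 - q ^ (M : ℤ))⁻¹ * A (t + 1) =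
      ∑ t ∈ Finset.range (M + 1), u t * ((1 - q ^ (t : ℤ)) * (1 - q ^ (M : ℤ))⁻¹) := by
    rw [Finset.sum_range_succ']
    simp only [Nat.cast_zero, sub_self, zpow_zero, zero_mul, mul_zero, add_zero]
    refine Finset.sum_congr rfl fun t ht => ?_
    simp only [hu]
    have hne : 1 - q ^ ((t : ℤ) + 1) ≠ 0 := h.one_sub_zpow_ne_zero (by omega)
    rw [show M - (t + 1) = M - 1 - t by omega, ha1, mul_inv]
    push_cast
    field_simp
  rw [c1, c2, ← Finset.sum_add_distrib]
  refine Finset.sum_congr rfl fun t _ => ?_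
  rw [← mul_add]
  have : (1 - q ^ ((t : ℤ) - M)) * (1 - q ^ (-(M : ℤ)))⁻¹ +
      (1 - q ^ (t : ℤ)) * (1 - q ^ (M : ℤ))⁻¹ = 1 := by
    rw [zpow_sub₀ hq, div_eq_mul_inv]
    have hqM : q ^ (M : ℤ) ≠ 0 := zpow_ne_zero _ hq
    rw [zpow_neg] at hM2 ⊢
    generalize q ^ (M : ℤ) = y at *
    generalize q ^ (t : ℤ) = w at *
    have : y - 1 ≠ 0 := fun h0 => hM1 (by linear_combination -h0)
    rw [show (1 - y⁻¹)⁻¹ = y * (y - 1)⁻¹ by field_simp,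
      show (1 - y)⁻¹ = - (y - 1)⁻¹ by rw [← inv_neg]; congr 1; ring]
    field_simp
    ring
  rw [this, mul_one]

lemma Generic.alternating_sum_inv_vertexDen {q z : F} (h : Generic q z) {N : ℕ} (hN : 0 < N) :
    ∑ m ∈ Finset.range (N + 1), (-1) ^ m * (vertexDen q z N m (N - m))⁻¹ = 0 := by
  rcases Nat.even_or_odd' N with ⟨M, rfl | rfl⟩
  · rw [Finset.sum_range_succ, sum_range_two_mul]
    simp only [pow_add, pow_mul, neg_one_sq, one_pow, pow_one, one_mul, neg_mul,
      Finset.sum_add_distrib, Finset.sum_neg_distrib]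
    rw [← h.sum_inv_vertexDen_even (by omega), Finset.sum_range_succ]
    ring
  · rw [show 2 * M + 1 + 1 = 2 * (M + 1) by ring, sum_range_two_mul]
    refine Finset.sum_eq_zero fun t ht => ?_
    rw [Finset.mem_range] at ht
    rw [vertexDen_of_add_eq q z (show 2 * t + (2 * M + 1 - 2 * t) = 2 * M + 1 by omega),
      vertexDen_of_add_eq q z (show 2 * t + 1 + (2 * M + 1 - (2 * t + 1)) = 2 * M + 1 by omega),
      show 2 * t / 2 = t by omega, show (2 * t + 1) / 2 = t by omega,
      show (2 * M + 1 - 2 * t) / 2 = M - t by omega,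
      show (2 * M + 1 - (2 * t + 1)) / 2 = M - t by omega, pow_succ, pow_mul]
    simp

lemma Generic.vertexSum_zero_eq_one {q z : F} (h : Generic q z) {N : ℕ} (hN : 0 < N) {k l r : ℤ}
    (hr : (if Odd N then r else k - r) = l) :
    vertexSum 0 q z N k l r = vertexSum 1 q z N k l r := by
  rw [← sub_eq_zero]
  simp only [vertexSum, Finset.sum_filter, Finset.sum_product, ← Finset.sum_sub_distrib]
  have key : ∀ m ∈ Finset.range (N + 1), ∑ n ∈ Finset.range (N + 1),
      ((if m + n < N ∨ m + n = N ∧ Even (m + 0) then vertexTerm q z N k l r m n else 0) -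
        if m + n < N ∨ m + n = N ∧ Even (m + 1) then vertexTerm q z N k l r m n else 0) =
      weight q z N (Mvec N k l r N 0) * ((-1) ^ m * (vertexDen q z N m (N - m))⁻¹) := by
    intro m hm
    rw [Finset.mem_range] at hm
    rw [Finset.sum_eq_single (N - m)]
    · have e : m + (N - m) = N := by omega
      simp only [vertexTerm, Mvec_of_add_eq e hr, e, lt_irrefl, true_and, false_or, add_zero,
        Nat.even_add_one]
      by_cases hm : Even m
      · simp [hm, div_eq_mul_inv]
      · simp [hm, (Nat.not_even_iff_odd.1 hm).neg_one_pow, div_eq_mul_inv]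
    · intro n _ hn
      have : ¬ m + n = N := by omega
      simp [this]
    · intro hn
      exact absurd (Finset.mem_range.2 (by omega)) hn
  rw [Finset.sum_congr rfl key, ← Finset.mul_sum, h.alternating_sum_inv_vertexDen hN, mul_zero]

/-! ### The generating function equals the vertex sums -/

/-- The vertex sum over even boundary terms is correct when `l` is at least the threshold
`r` (for `N` odd) or `k - r` (for `N` even), and the odd one when `l` is below the threshold. -/
theorem latticeGen_eq_vertexSum {q : F} {k r : ℤ} (hr0 : 0 ≤ r) (hrk : r ≤ k) (N : ℕ) :
    ∀ (z : F), Generic q z → ∀ l : ℤ, 0 ≤ l → l ≤ k →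
      ((if Odd N then r else k - r) ≤ l → latticeGen q z N k l r = vertexSum 0 q z N k l r) ∧
      (l < (if Odd N then r else k - r) →
        latticeGen q z N k l r = vertexSum 1 q z N k l r) := by
  induction N with
  | zero =>
    intro z h l hl hlk
    simp only [Nat.not_odd_zero, if_false]
    constructor
    · intro hle
      have hf : (Finset.range (0 + 1) ×ˢ Finset.range (0 + 1)).filter
          (fun p : ℕ × ℕ => p.1 + p.2 < 0 ∨ (p.1 + p.2 = 0 ∧ Even (p.1 + 0))) = {(0, 0)} := by
        decide
      rw [latticeGen, if_pos rfl, if_pos (by omega), vertexSum, hf, Finset.sum_singleton]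
      simp [vertexTerm, vertexDen, weight, phiQ, phiZ]
    · intro hlt
      have hf : (Finset.range (0 + 1) ×ˢ Finset.range (0 + 1)).filter
          (fun p : ℕ × ℕ => p.1 + p.2 < 0 ∨ (p.1 + p.2 = 0 ∧ Even (p.1 + 1))) = ∅ := by
        decide
      rw [latticeGen, if_pos rfl, if_neg (by omega), vertexSum, hf, Finset.sum_empty]
  | succ N ih =>
    intro z h
    set c : ℤ := if Odd (N + 1) then r else k - r with hc
    have hcN : (if Odd N then r else k - r) = k - c := by
      simp only [hc, Nat.odd_add_one]
      split_ifs <;> omega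
    simp only [hcN] at ih
    have hc0 : 0 ≤ c := by simp only [hc]; split_ifs <;> omega
    have hodd : ∀ l : ℤ, -1 ≤ l → l ≤ k → l ≤ c →
        latticeGen q z (N + 1) k l r = vertexSum 1 q z (N + 1) k l r := by
      intro l hl
      induction l, hl using Int.leInduction with
      | base => intros; rw [latticeGen_neg_one, h.vertexSum_one_neg_one]
      | succ l hl ihl =>
        intro hlk hlc
        rw [latticeGen_step h.q_ne_zero h.z_ne_zero _ _ _ _ (by omega), h.vertexSum_step,
          add_sub_cancel_right, ihl (by omega) (by omega),
          (ih (q * z) h.shift (k - (l + 1)) (by omega) (by omega)).1 (by omega),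
          vertexSum_add_two]
    have heven : ∀ l : ℤ, c ≤ l → l ≤ k →
        latticeGen q z (N + 1) k l r = vertexSum 0 q z (N + 1) k l r := by
      intro l hl
      induction l, hl using Int.leInduction with
      | base =>
        intro hck
        rw [hodd c (by omega) hck le_rfl, h.vertexSum_zero_eq_one (Nat.succ_pos N) rfl]
      | succ l hl ihl =>
        intro hlk
        rw [latticeGen_step h.q_ne_zero h.z_ne_zero _ _ _ _ (by omega), h.vertexSum_step,
          add_sub_cancel_right, ihl (by omega),
          (ih (q * z) h.shift (k - (l + 1)) (by omega) (by omega)).2 (by omega)]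
    exact fun l hl hlk => ⟨fun hcl => heven l hcl hlk, fun hlc => hodd l (by omega) hlk hlc.le⟩

end GenericField

/-- The variables `q` and `z` of `ℚ(q,z)` are generic. -/
lemma generic_qK_zK : Generic qK zK := by
  have hinj : Function.Injective (algebraMap (MvPolynomial (Fin 2) ℚ) K) :=
    IsFractionRing.injective _ _
  have hq : qK ≠ 0 := (map_ne_zero_iff _ hinj).2 (X_ne_zero 0)
  have hz : zK ≠ 0 := (map_ne_zero_iff _ hinj).2 (X_ne_zero 1)
  have hpow : ∀ n : ℕ, n ≠ 0 → qK ^ n ≠ 1 := by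
    intro n hn h
    rw [qK, ← map_pow, ← map_one (algebraMap (MvPolynomial (Fin 2) ℚ) K)] at h
    have := congrArg (eval ![2, 0]) (hinj h)
    simp only [map_pow, eval_X, map_one, Matrix.cons_val_zero] at this
    exact (one_lt_pow₀ (by norm_num : (1 : ℚ) < 2) hn).ne' this
  refine ⟨hq, hz, ?_, ?_⟩
  · intro n hn h
    rcases Int.natAbs_eq n with e | e <;> rw [e] at h
    · exact hpow n.natAbs (by omega) (by rwa [zpow_natCast] at h)
    · exact hpow n.natAbs (by omega) (by rwa [zpow_neg, zpow_natCast, inv_eq_one] at h)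
  · intro n h
    rcases Int.natAbs_eq n with e | e <;> rw [e] at h
    · rw [zpow_natCast, qK, zK, ← map_pow, ← map_mul,
        ← map_one (algebraMap (MvPolynomial (Fin 2) ℚ) K)] at h
      have := congrArg (eval ![2, 0]) (hinj h)
      simp at this
    · rw [zpow_neg, zpow_natCast, inv_mul_eq_one₀ (pow_ne_zero _ hq), qK, zK, ← map_pow] at h
      have := congrArg (eval ![2, 0]) (hinj h)
      simp at this

theorem lattice_gen_poly_eq_dE_odd (N : ℕ) (hN : 3 ≤ N) (hNodd : Odd N)
    (k l r : ℤ) (hk : 1 ≤ k) (hr0 : 0 ≤ r) (hrl : r ≤ l) (hlk : l ≤ k) :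
    pPoly N k l r = dE N k l r := by
  have h := (latticeGen_eq_vertexSum hr0 (hrl.trans hlk) N zK generic_qK_zK l
    (hr0.trans hrl) hlk).1 (by rwa [if_pos hNodd])
  rw [latticeGen, if_neg (by omega)] at h
  exact h

end
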